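/- arXiv:1407.5959 — 6 statements merged into one kernel-verified Lean document; each statement's English description precedes it below -/
import Mathlib

section
/- For all integers k ≥ 1 and n ≥ k, the domination number of the (k,n)-path satisfies γ(P^k_n) = ⌈n/(2k+1)⌉. -/
open Polynomial

/-- `S` is a dominating set of `G`. -/
def IsDomSet {V : Type*} (G : SimpleGraph V) (S : Finset V) : Prop :=
  ∀ v : V, v ∉ S → ∃ u ∈ S, G.Adj u v

/-- The domination number of `G`. -/
noncomputable def domNum {V : Type*} [Fintype V] (G : SimpleGraph V) : ℕ :=
  sInf {i : ℕ | ∃ S : Finset V, IsDomSet G S ∧ S.card = i}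

open scoped Classical in
/-- The domination polynomial of `G`, `D(G,x) = Σ_S x^{|S|}` over dominating sets `S`. -/
noncomputable def domPoly {V : Type*} [Fintype V] (G : SimpleGraph V) : Polynomial ℤ :=
  ∑ S ∈ Finset.univ.filter (fun S : Finset V => IsDomSet G S), (X : Polynomial ℤ) ^ S.card

/-- The `(k,n)`-path: vertices `v_1,…,v_n`, distinct `v_i, v_j` adjacent iff `|i-j| ≤ k`. -/
def kPath (k n : ℕ) : SimpleGraph (Fin n) :=
  SimpleGraph.fromRel (fun i j => |(i.val : ℤ) - (j.val : ℤ)| ≤ (k : ℤ))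

/-- The `(k,n)`-cycle: distinct `v_i, v_j` adjacent iff `|i-j| ≤ k` or `{i,j} = {1,n}`. -/
def kCycle (k n : ℕ) : SimpleGraph (Fin n) :=
  SimpleGraph.fromRel (fun i j =>
    |(i.val : ℤ) - (j.val : ℤ)| ≤ (k : ℤ) ∨ |(i.val : ℤ) - (j.val : ℤ)| = (n : ℤ) - 1)

/-- The `(k,n)`-wheel: the `(k,n)`-cycle joined with one extra vertex (the last vertex,
of index `n`) adjacent to all others. -/
def kWheel (k n : ℕ) : SimpleGraph (Fin (n + 1)) :=
  SimpleGraph.fromRel (fun i j =>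
    (i.val < n ∧ j.val < n ∧
      (|(i.val : ℤ) - (j.val : ℤ)| ≤ (k : ℤ) ∨ |(i.val : ℤ) - (j.val : ℤ)| = (n : ℤ) - 1)) ∨
    j.val = n)

/-- The `(k,n)`-star on `n` vertices: `K_k + \bar K_{n-k}`; the first `k` vertices form a
clique, the rest are independent, and every clique vertex is joined to every other vertex. -/
def kStar (k n : ℕ) : SimpleGraph (Fin n) :=
  SimpleGraph.fromRel (fun i _ => i.val < k)

/-- The corona `G ∘ H`. -/
def corona {V W : Type*} (G : SimpleGraph V) (H : SimpleGraph W) :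
    SimpleGraph (V ⊕ V × W) :=
  SimpleGraph.fromRel (fun a b =>
    (∃ u v, a = Sum.inl u ∧ b = Sum.inl v ∧ G.Adj u v) ∨
    (∃ u w w', a = Sum.inr (u, w) ∧ b = Sum.inr (u, w') ∧ H.Adj w w') ∨
    (∃ u w, a = Sum.inl u ∧ b = Sum.inr (u, w)))

theorem kPath_adj {k n : ℕ} {i j : Fin n} :
    (kPath k n).Adj i j ↔ i ≠ j ∧ |(i.val : ℤ) - (j.val : ℤ)| ≤ (k : ℤ) := by
  simp [kPath, abs_sub_comm (j.val : ℤ)]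

theorem isDomSet_kPath_iff {k n : ℕ} {S : Finset (Fin n)} :
    IsDomSet (kPath k n) S ↔ ∀ v : Fin n, ∃ u ∈ S, |(u.val : ℤ) - (v.val : ℤ)| ≤ (k : ℤ) := by
  refine forall_congr' fun v => ⟨fun h => ?_, fun ⟨u, hu, huv⟩ hv => ?_⟩
  · by_cases hv : v ∈ S
    · exact ⟨v, hv, by simp⟩
    · obtain ⟨u, hu, huv⟩ := h hv
      exact ⟨u, hu, (kPath_adj.1 huv).2⟩
  · exact ⟨u, hu, kPath_adj.2 ⟨fun e => hv (e ▸ hu), huv⟩⟩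

/-- A closed neighbourhood in `kPath k n` has at most `2 * k + 1` vertices. -/
theorem card_filter_abs_sub_le (k n : ℕ) (u : Fin n) :
    (Finset.univ.filter fun v : Fin n => |(u.val : ℤ) - (v.val : ℤ)| ≤ (k : ℤ)).card
      ≤ 2 * k + 1 := by
  calc _ ≤ (Finset.Icc (u.val - k) (u.val + k)).card := by
        refine Finset.card_le_card_of_injOn Fin.val (fun v hv => ?_) Fin.val_injective.injOn
        simp only [Finset.coe_filter, Finset.mem_univ, true_and, Set.mem_ofPred_eq, abs_le] at hv
        simp only [Finset.coe_Icc, Set.mem_Icc]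
        omega
    _ ≤ 2 * k + 1 := by
        rw [Nat.card_Icc]
        omega

theorem IsDomSet.ceilDiv_le_card {k n : ℕ} {S : Finset (Fin n)} (hS : IsDomSet (kPath k n) S) :
    n ⌈/⌉ (2 * k + 1) ≤ S.card := by
  rw [ceilDiv_le_iff_le_mul (by omega), mul_comm]
  calc n = (Finset.univ : Finset (Fin n)).card := by simp
    _ ≤ (S.biUnion fun u =>
          Finset.univ.filter fun v : Fin n => |(u.val : ℤ) - (v.val : ℤ)| ≤ (k : ℤ)).card := by
        refine Finset.card_le_card fun v _ => ?_
        simpa using isDomSet_kPath_iff.1 hS v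
    _ ≤ S.card * (2 * k + 1) :=
        Finset.card_biUnion_le_card_mul _ _ _ fun u _ => card_filter_abs_sub_le k n u

theorem exists_isDomSet_kPath_card_le (k n : ℕ) :
    ∃ S : Finset (Fin n), IsDomSet (kPath k n) S ∧ S.card ≤ n ⌈/⌉ (2 * k + 1) := by
  rcases Nat.eq_zero_or_pos n with rfl | hn
  · exact ⟨∅, fun v => v.elim0, by simp⟩
  refine ⟨(Finset.range (n ⌈/⌉ (2 * k + 1))).image fun i =>
    ⟨min (i * (2 * k + 1) + k) (n - 1), by omega⟩, isDomSet_kPath_iff.2 fun v => ?_,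
    Finset.card_image_le.trans (Finset.card_range _).le⟩
  refine ⟨_, Finset.mem_image_of_mem _ (a := v.val / (2 * k + 1)) ?_, ?_⟩
  · rw [Finset.mem_range, Nat.div_lt_iff_lt_mul (by omega), mul_comm]
    exact v.isLt.trans_le ((ceilDiv_le_iff_le_mul (by omega)).1 le_rfl)
  · have h₁ := Nat.div_add_mod' v.val (2 * k + 1)
    have h₂ := Nat.mod_lt v.val (show 0 < 2 * k + 1 by omega)
    have h₃ := v.isLt
    rw [abs_le]
    dsimp only
    generalize v.val / (2 * k + 1) * (2 * k + 1) = q at *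
    omega

theorem domNum_kPath (k n : ℕ) (hk : 1 ≤ k) (hn : k ≤ n) :
    domNum (kPath k n) = n ⌈/⌉ (2 * k + 1) := by
  obtain ⟨S, hS, hcard⟩ := exists_isDomSet_kPath_card_le k n
  unfold domNum
  refine le_antisymm (le_trans (Nat.sInf_le ⟨S, hS, rfl⟩) hcard) (le_csInf ⟨_, S, hS, rfl⟩ ?_)
  rintro _ ⟨T, hT, rfl⟩
  exact hT.ceilDiv_le_card
end

section
/- For all integers k ≥ 1 and n ≥ k+2, the domination number of the (k,n)-cycle satisfies γ(C^k_n) = ⌈n/(2k+1)⌉. -/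
open Polynomial

lemma kCycle_adj {k n : ℕ} {u v : Fin n} :
    (kCycle k n).Adj u v ↔ u.val ≠ v.val ∧ ((u.val ≤ v.val + k ∧ v.val ≤ u.val + k) ∨
      u.val + 1 = v.val + n ∨ v.val + 1 = u.val + n) := by
  simp only [kCycle, SimpleGraph.fromRel_adj, ne_eq, Fin.ext_iff]
  grind

/-- If every closed neighbourhood has at most `d` elements, a dominating set `S` covers at most
`S.card * d` vertices. -/
lemma IsDomSet.card_le_mul {V : Type*} [Fintype V] [DecidableEq V] {G : SimpleGraph V}
    [DecidableRel G.Adj] {S : Finset V} (hS : IsDomSet G S) {d : ℕ}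
    (hd : ∀ u, (Finset.univ.filter fun v => u = v ∨ G.Adj u v).card ≤ d) :
    Fintype.card V ≤ S.card * d := by
  have hcover : (Finset.univ : Finset V) ⊆
      S.biUnion fun u => Finset.univ.filter fun v => u = v ∨ G.Adj u v := by
    intro v _
    simp only [Finset.mem_biUnion, Finset.mem_filter, Finset.mem_univ, true_and]
    by_cases hv : v ∈ S
    · exact ⟨v, hv, Or.inl rfl⟩
    · obtain ⟨u, hu, huv⟩ := hS v hv
      exact ⟨u, hu, Or.inr huv⟩
  exact (Finset.card_le_card hcover).trans
    (Finset.card_biUnion_le_card_mul _ _ _ fun u _ => hd u)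

open scoped Classical in
lemma card_closedNeighborhood_kCycle_le {k n : ℕ} (hk : 1 ≤ k) (u : Fin n) :
    (Finset.univ.filter fun v => u = v ∨ (kCycle k n).Adj u v).card ≤ 2 * k + 1 := by
  have hu := u.isLt
  have key : ∀ T : Finset ℕ, T.card ≤ 2 * k + 1 →
      (∀ v : Fin n, u = v ∨ (kCycle k n).Adj u v → v.val ∈ T) →
      (Finset.univ.filter fun v => u = v ∨ (kCycle k n).Adj u v).card ≤ 2 * k + 1 := by
    intro T hT h
    refine (Finset.card_le_card_of_injOn Fin.val (fun v hv => h v ?_)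
      Fin.val_injective.injOn).trans hT
    simpa using hv
  simp only [kCycle_adj, Fin.ext_iff] at key ⊢
  by_cases h0 : u.val = 0
  · refine key (insert (n - 1) (Finset.range (k + 1))) ?_ ?_
    · have := Finset.card_insert_le (n - 1) (Finset.range (k + 1))
      rw [Finset.card_range] at this
      omega
    · intro v hv
      simp only [Finset.mem_insert, Finset.mem_range]
      omega
  · by_cases h1 : u.val + 1 = n
    · refine key (insert 0 (Finset.Icc (u.val - k) u.val)) ?_ ?_
      · have := Finset.card_insert_le 0 (Finset.Icc (u.val - k) u.val)
        rw [Nat.card_Icc] at this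
        omega
      · intro v hv
        simp only [Finset.mem_insert, Finset.mem_Icc]
        omega
    · refine key (Finset.Icc (u.val - k) (u.val + k)) ?_ ?_
      · rw [Nat.card_Icc]
        omega
      · intro v hv
        simp only [Finset.mem_Icc]
        omega

lemma exists_isDomSet_kCycle (k n : ℕ) (hn : 0 < n) :
    ∃ S : Finset (Fin n), IsDomSet (kCycle k n) S ∧ S.card ≤ n ⌈/⌉ (2 * k + 1) := by
  let c : ℕ → Fin n := fun j => ⟨min (k + (2 * k + 1) * j) (n - 1), by omega⟩
  refine ⟨(Finset.range (n ⌈/⌉ (2 * k + 1))).image c, ?_,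
    Finset.card_image_le.trans (Finset.card_range _).le⟩
  intro v hv
  have hvn := v.isLt
  have hc : c (v.val / (2 * k + 1)) ∈ (Finset.range (n ⌈/⌉ (2 * k + 1))).image c := by
    refine Finset.mem_image_of_mem c (Finset.mem_range.2 ?_)
    have h : n ≤ (2 * k + 1) * (n ⌈/⌉ (2 * k + 1)) :=
      (ceilDiv_le_iff_le_mul (Nat.succ_pos _)).1 le_rfl
    exact Nat.div_lt_of_lt_mul (by omega)
  refine ⟨_, hc, kCycle_adj.2 ⟨fun h => hv (Fin.ext h ▸ hc), Or.inl ?_⟩⟩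
  have hdiv := Nat.div_add_mod v.val (2 * k + 1)
  have hmod := Nat.mod_lt v.val (show 0 < 2 * k + 1 by omega)
  simp only [c]
  omega

theorem domNum_kCycle (k n : ℕ) (hk : 1 ≤ k) (hn : k + 2 ≤ n) :
    domNum (kCycle k n) = n ⌈/⌉ (2 * k + 1) := by
  obtain ⟨S, hS, hcard⟩ := exists_isDomSet_kCycle k n (by omega)
  refine le_antisymm (le_trans (Nat.sInf_le ⟨S, hS, rfl⟩) hcard) ?_
  refine le_csInf ⟨_, S, hS, rfl⟩ ?_
  rintro _ ⟨T, hT, rfl⟩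
  classical
  rw [ceilDiv_le_iff_le_mul (by omega), mul_comm]
  simpa using hT.card_le_mul (card_closedNeighborhood_kCycle_le hk)
end

section
/- For all integers k ≥ 1 and n ≥ k+2, the domination polynomial of the (k,n)-wheel (a graph on n+1 vertices) satisfies D(W^k_n, x) = x·(1+x)^n + D(C^k_n, x) as polynomials in x. -/
open Polynomial

theorem sum_finset_fin_succ {M : Type*} [AddCommMonoid M] {n : ℕ}
    (f : Finset (Fin (n + 1)) → M) :
    ∑ S, f S = ∑ T : Finset (Fin n), f (T.map Fin.castSuccEmb) +
      ∑ T : Finset (Fin n), f (insert (Fin.last n) (T.map Fin.castSuccEmb)) := by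
  classical
  have huniv : (Finset.univ : Finset (Fin (n + 1))) =
      insert (Fin.last n) (Finset.univ.image Fin.castSucc) := by
    ext i
    cases i using Fin.lastCases <;> simp
  have hinj : Function.Injective (Finset.image (Fin.castSucc (n := n))) :=
    Finset.image_injective (Fin.castSucc_injective n)
  rw [← Finset.powerset_univ, huniv, Finset.sum_powerset_insert (by simp),
    Finset.powerset_image, Finset.sum_image hinj.injOn, Finset.sum_image hinj.injOn,
    Finset.powerset_univ]
  simp only [Finset.map_eq_image, Fin.coe_castSuccEmb]

/-- Joining a vertex to a nonempty graph adds `x (1 + x)^n` to the domination polynomial. -/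
theorem domPoly_eq_add_of_adj_last {n : ℕ} (hn : 0 < n) (G : SimpleGraph (Fin n))
    (W : SimpleGraph (Fin (n + 1)))
    (hG : ∀ i j, W.Adj (Fin.castSucc i) (Fin.castSucc j) ↔ G.Adj i j)
    (hlast : ∀ i, W.Adj (Fin.last n) (Fin.castSucc i)) :
    domPoly W = X * (1 + X) ^ n + domPoly G := by
  classical
  have hub (T : Finset (Fin n)) :
      IsDomSet W (insert (Fin.last n) (T.map Fin.castSuccEmb)) := by
    intro v hv
    cases v using Fin.lastCases with
    | last => simp at hv
    | cast i => exact ⟨_, Finset.mem_insert_self _ _, hlast i⟩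
  have rim (T : Finset (Fin n)) : IsDomSet W (T.map Fin.castSuccEmb) ↔ IsDomSet G T := by
    constructor
    · intro h v hv
      obtain ⟨u, hu, huv⟩ := h v.castSucc (by simpa using hv)
      obtain ⟨w, hw, rfl⟩ := Finset.mem_map.mp hu
      exact ⟨w, hw, (hG w v).mp huv⟩
    · intro h v hv
      cases v using Fin.lastCases with
      | last =>
        obtain ⟨w, hw⟩ : T.Nonempty := by
          by_contra hT
          obtain ⟨u, hu, -⟩ := h ⟨0, hn⟩ fun hmem => hT ⟨_, hmem⟩
          exact hT ⟨u, hu⟩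
        exact ⟨w.castSucc, Finset.mem_map_of_mem _ hw, (hlast w).symm⟩
      | cast i =>
        obtain ⟨u, hu, hui⟩ := h i (by simpa using hv)
        exact ⟨u.castSucc, Finset.mem_map_of_mem _ hu, (hG u i).mpr hui⟩
  have hcard (T : Finset (Fin n)) :
      (insert (Fin.last n) (T.map Fin.castSuccEmb)).card = T.card + 1 := by
    rw [Finset.card_insert_of_notMem (by simp), Finset.card_map]
  have hsum : ∑ T : Finset (Fin n), (X : ℤ[X]) ^ T.card = (1 + X) ^ n := by
    simpa [add_comm] using Fin.sum_pow_mul_eq_add_pow (n := n) (X : ℤ[X]) 1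
  simp only [domPoly, Finset.sum_filter]
  rw [sum_finset_fin_succ]
  simp only [hub, rim, hcard, Finset.card_map, if_true, pow_succ', ← Finset.mul_sum, hsum]
  rw [add_comm]

theorem domPoly_kWheel (k n : ℕ) (hk : 1 ≤ k) (hn : k + 2 ≤ n) :
    domPoly (kWheel k n) = X * (1 + X) ^ n + domPoly (kCycle k n) := by
  refine domPoly_eq_add_of_adj_last (by omega) _ _ (fun i j => ?_) (fun i => ?_)
  · have hi := i.isLt
    have hj := j.isLt
    simp [kWheel, kCycle, SimpleGraph.fromRel_adj, hi.ne, hj.ne]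
  · simp [kWheel, SimpleGraph.fromRel_adj, Fin.ext_iff, i.isLt.ne']
end

section
/- For all integers n > k ≥ 1, the domination polynomial of the (k,n)-star satisfies D(S_{k,n−k}, x) = (1+x)^{n−k}·((1+x)^k − 1) + x^{n−k} as polynomials in x. -/
open Polynomial

theorem kStar_adj {k n : ℕ} {u v : Fin n} :
    (kStar k n).Adj u v ↔ u ≠ v ∧ (u.val < k ∨ v.val < k) :=
  SimpleGraph.fromRel_adj _ _ _

/-- The independent vertices of the `(k,n)`-star. -/
def kStarLeaves (k n : ℕ) : Finset (Fin n) :=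
  Finset.univ.filter (fun i => k ≤ i.val)

theorem mem_kStarLeaves {k n : ℕ} {i : Fin n} : i ∈ kStarLeaves k n ↔ k ≤ i.val := by
  simp [kStarLeaves]

theorem card_kStarLeaves (k n : ℕ) : (kStarLeaves k n).card = n - k := by
  have h : (Finset.univ.filter fun i : Fin n => i.val < k).card = min n k :=
    Fin.card_filter_val_lt
  have h' := Finset.card_filter_add_card_filter_not (s := (Finset.univ : Finset (Fin n)))
    (fun i => i.val < k)
  simp only [not_lt, Finset.card_univ, Fintype.card_fin] at h'
  change (Finset.univ.filter fun i : Fin n => k ≤ i.val).card = n - k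
  omega

/-- The dominating sets of the star are those meeting the clique, and the set of leaves. -/
theorem isDomSet_kStar_iff {k n : ℕ} (hn : k < n) (S : Finset (Fin n)) :
    IsDomSet (kStar k n) S ↔ ¬ S ⊆ kStarLeaves k n ∨ S = kStarLeaves k n := by
  constructor
  · intro h
    by_contra! hS
    obtain ⟨hsub, hne⟩ := hS
    refine hne (hsub.antisymm fun v hv => ?_)
    by_contra hvS
    obtain ⟨u, hu, huv⟩ := h v hvS
    have hu' := mem_kStarLeaves.1 (hsub hu)
    have hv' := mem_kStarLeaves.1 hv
    rcases (kStar_adj.1 huv).2 with h | h <;> omega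
  · rintro (h | rfl) v hv
    · obtain ⟨u, hu, huL⟩ := Finset.not_subset.1 h
      rw [mem_kStarLeaves, not_le] at huL
      exact ⟨u, hu, kStar_adj.2 ⟨fun e => hv (e ▸ hu), Or.inl huL⟩⟩
    · have hvk : v.val < k := by simpa [mem_kStarLeaves] using hv
      exact ⟨⟨k, hn⟩, mem_kStarLeaves.2 le_rfl,
        kStar_adj.2 ⟨fun e => by simp [← e] at hvk, Or.inr hvk⟩⟩

theorem sum_powerset_pow_card {α R : Type*} [CommSemiring R] (s : Finset α) (x : R) :
    ∑ t ∈ s.powerset, x ^ t.card = (1 + x) ^ s.card := by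
  classical
  simpa using (Finset.prod_one_add (f := fun _ : α => x) s).symm

theorem domPoly_kStar (k n : ℕ) (hk : 1 ≤ k) (hn : k < n) :
    domPoly (kStar k n) = (1 + X) ^ (n - k) * ((1 + X) ^ k - 1) + X ^ (n - k) := by
  classical
  have hall : ∑ S : Finset (Fin n), (X : ℤ[X]) ^ S.card = (1 + X) ^ n := by
    simpa using sum_powerset_pow_card (Finset.univ : Finset (Fin n)) (X : ℤ[X])
  have hleaves : ∑ S ∈ Finset.univ.filter (fun S => S ⊆ kStarLeaves k n), (X : ℤ[X]) ^ S.card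
      = (1 + X) ^ (n - k) := by
    rw [← card_kStarLeaves k n, ← sum_powerset_pow_card]
    congr 1
    ext S
    simp
  have hdom : domPoly (kStar k n)
      = ∑ S ∈ Finset.univ.filter (fun S => ¬ S ⊆ kStarLeaves k n), (X : ℤ[X]) ^ S.card
        + X ^ (n - k) := by
    rw [← card_kStarLeaves k n, ← Finset.sum_singleton (fun S : Finset (Fin n) => X ^ S.card),
      ← Finset.sum_union (by simp)]
    refine Finset.sum_congr ?_ fun _ _ => rfl
    ext S
    simp [isDomSet_kStar_iff hn, or_comm]
  have hsplit := Finset.sum_filter_add_sum_filter_not Finset.univ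
    (fun S => S ⊆ kStarLeaves k n) (fun S : Finset (Fin n) => (X : ℤ[X]) ^ S.card)
  rw [hleaves, hall] at hsplit
  have hpow : (1 + X : ℤ[X]) ^ n = (1 + X) ^ (n - k) * (1 + X) ^ k := by
    rw [← pow_add, Nat.sub_add_cancel hn.le]
  rw [hdom]
  linear_combination hsplit + hpow
end

section
/- For all integers k ≥ 1 and n ≥ k, the domination polynomial of the (k,n)-path evaluated at −1 satisfies D(P^k_n, −1) = (−1)^{⌊(n+k)/(k+1)⌋}. -/
open Polynomial

open scoped Classical in
/-- The signed count `∑ (-1) ^ |S|` of the sets `S ⊆ {0, …, n - 1}` that come within distance `k`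
of every `v < m`. -/
noncomputable def signedCoverCount (k n m : ℕ) : ℤ :=
  ∑ S ∈ (Finset.range n).powerset,
    if ∀ v < m, ∃ u ∈ S, u ≤ v + k ∧ v ≤ u + k then (-1) ^ S.card else 0

theorem signedCoverCount_eq_zero_of_lt {k n m : ℕ} (h : n + k < m) :
    signedCoverCount k n m = 0 := by
  refine Finset.sum_eq_zero fun S hS => if_neg fun hcov => ?_
  obtain ⟨u, hu, _, hvu⟩ := hcov (n + k) h
  have := Finset.mem_range.1 (Finset.mem_powerset.1 hS hu)
  omega

theorem cover_insert_iff {k n m : ℕ} (hm : m ≤ n + k + 1) (S : Finset ℕ) :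
    (∀ v < m, ∃ u ∈ insert n S, u ≤ v + k ∧ v ≤ u + k) ↔
      ∀ v < min m (n - k), ∃ u ∈ S, u ≤ v + k ∧ v ≤ u + k := by
  constructor
  · intro h v hv
    obtain ⟨u, hu, huv⟩ := h v (by omega)
    rcases Finset.mem_insert.1 hu with rfl | hu
    · omega
    · exact ⟨u, hu, huv⟩
  · intro h v hv
    by_cases hvn : v < n - k
    · obtain ⟨u, hu, huv⟩ := h v (by omega)
      exact ⟨u, Finset.mem_insert_of_mem hu, huv⟩
    · exact ⟨n, Finset.mem_insert_self n S, by omega⟩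

theorem signedCoverCount_succ {k n m : ℕ} (hm : m ≤ n + k + 1) :
    signedCoverCount k (n + 1) m =
      signedCoverCount k n m - signedCoverCount k n (min m (n - k)) := by
  unfold signedCoverCount
  rw [Finset.range_add_one, Finset.sum_powerset_insert Finset.notMem_range_self, sub_eq_add_neg,
    ← Finset.sum_neg_distrib]
  congr 1
  refine Finset.sum_congr rfl fun S hS => ?_
  have hnS : n ∉ S := fun h => Finset.notMem_range_self (Finset.mem_powerset.1 hS h)
  simp only [cover_insert_iff hm, Finset.card_insert_of_notMem hnS, pow_succ]
  split_ifs <;> simp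

theorem signedCoverCount_zero_right (k n : ℕ) :
    signedCoverCount k n 0 = if n = 0 then 1 else 0 := by
  cases n with
  | zero => simp [signedCoverCount]
  | succ n => simp [signedCoverCount_succ]

theorem ceilDiv_mod_two_of_le {k n : ℕ} (h0 : 0 < n) (h1 : n ≤ k + 1) :
    (n + k) / (k + 1) % 2 = 1 := by
  rw [Nat.div_eq_of_lt_le (k := 1) (by omega) (by omega)]

theorem ceilDiv_mod_two_of_lt_of_le {k n : ℕ} (h0 : k + 1 < n) (h1 : n ≤ 2 * k + 2) :
    (n + k) / (k + 1) % 2 = 0 := by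
  rw [Nat.div_eq_of_lt_le (k := 2) (by omega) (by omega)]

theorem ceilDiv_mod_two_add_period (k n : ℕ) :
    (n + 2 * (k + 1) + k) / (k + 1) % 2 = (n + k) / (k + 1) % 2 := by
  rw [Nat.add_right_comm, Nat.add_mul_div_right _ _ k.succ_pos, Nat.add_mod_right]

theorem signedCoverCount_eq {k : ℕ} (n : ℕ) : ∀ m, 1 ≤ m → n ≤ m + k → m ≤ n + k + 1 →
    signedCoverCount k n m =
      ((m - (k + 1) + k) / (k + 1) % 2 : ℕ) - ((n + k) / (k + 1) % 2 : ℕ) := by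
  induction n with
  | zero =>
    intro m h1 _ h3
    rw [show m - (k + 1) = 0 by omega, sub_self]
    simp only [signedCoverCount, Finset.range_zero, Finset.powerset_empty, Finset.sum_singleton]
    exact if_neg fun h => by simpa using h 0 h1
  | succ n ih =>
    intro m h1 h2 h3
    rcases h3.eq_or_lt with rfl | h3
    · rw [signedCoverCount_eq_zero_of_lt (by omega),
        show n + 1 + k + 1 - (k + 1) = n + 1 by omega, sub_self]
    have step : signedCoverCount k n (n - k) =
        ((n + 1 + k) / (k + 1) % 2 : ℕ) - ((n + k) / (k + 1) % 2 : ℕ) := by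
      rcases le_or_gt n k with hnk | hnk
      · rw [Nat.sub_eq_zero_of_le hnk, signedCoverCount_zero_right,
          ceilDiv_mod_two_of_le n.succ_pos (by omega)]
        rcases n.eq_zero_or_pos with rfl | hn
        · simp [Nat.div_eq_of_lt k.lt_succ_self]
        · rw [ceilDiv_mod_two_of_le hn (by omega), if_neg hn.ne', sub_self]
      · rw [ih (n - k) (by omega) (by omega) (by omega)]
        congr 2
        rcases le_or_gt n (2 * k) with hn | hn
        · rw [ceilDiv_mod_two_of_lt_of_le (n := n + 1) (by omega) (by omega),
            show n - k - (k + 1) = 0 by omega]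
          simp [Nat.div_eq_of_lt k.lt_succ_self]
        · rw [← ceilDiv_mod_two_add_period,
            show n - k - (k + 1) + 2 * (k + 1) = n + 1 by omega]
    rw [signedCoverCount_succ (by omega), min_eq_right (by omega), step,
      ih m h1 (by omega) (by omega)]
    ring

theorem eval_neg_one_domPoly_kPath (k n : ℕ) :
    (domPoly (kPath k n)).eval (-1) = signedCoverCount k n n := by
  classical
  unfold domPoly signedCoverCount
  rw [Finset.sum_filter, eval_finsetSum]
  refine Finset.sum_nbij (fun S => S.map Fin.valEmbedding) ?_ ?_ ?_ ?_
  · intro S _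
    simp [Finset.subset_iff]
  · exact fun S _ T _ h => Finset.map_injective _ h
  · intro T hT
    refine ⟨T.attachFin fun i hi => Finset.mem_range.1 (Finset.mem_powerset.1 hT hi), by simp, ?_⟩
    ext; simp
  · intro S _
    have key : IsDomSet (kPath k n) S ↔
        ∀ v < n, ∃ u ∈ S.map Fin.valEmbedding, u ≤ v + k ∧ v ≤ u + k := by
      constructor
      · intro h v hv
        by_cases hvS : (⟨v, hv⟩ : Fin n) ∈ S
        · exact ⟨v, Finset.mem_map_of_mem Fin.valEmbedding hvS, by omega, by omega⟩
        · obtain ⟨u, hu, -, huv⟩ := h ⟨v, hv⟩ hvS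
          refine ⟨u, Finset.mem_map_of_mem Fin.valEmbedding hu, ?_⟩
          simp only [abs_le] at huv
          omega
      · intro h v hvS
        obtain ⟨_, hu, huv⟩ := h v v.isLt
        obtain ⟨u, huS, rfl⟩ := Finset.mem_map.1 hu
        refine ⟨u, huS, fun huv => hvS (huv ▸ huS), Or.inl ?_⟩
        simp only [Fin.valEmbedding_apply] at huv
        exact abs_le.2 (by omega)
    simp only [← key, Finset.card_map]
    split_ifs <;> simp

theorem domPoly_kPath_eval_neg_one (k n : ℕ) (hk : 1 ≤ k) (hn : k ≤ n) :
    (domPoly (kPath k n)).eval (-1) = (-1 : ℤ) ^ ((n + k) / (k + 1)) := by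
  rw [eval_neg_one_domPoly_kPath, signedCoverCount_eq n n (by omega) (by omega) (by omega)]
  rcases hn.eq_or_lt with rfl | hn
  · rw [Nat.sub_eq_zero_of_le k.le_succ,
      Nat.div_eq_of_lt_le (m := k + k) (n := k + 1) (k := 1) (by omega) (by omega)]
    simp [Nat.div_eq_of_lt k.lt_succ_self]
  · obtain ⟨d, rfl⟩ := Nat.exists_eq_add_of_le' (Nat.succ_le_of_lt hn)
    rw [Nat.succ_eq_add_one, Nat.add_sub_cancel, Nat.add_right_comm,
      Nat.add_div_right _ k.succ_pos]
    rcases Nat.even_or_odd ((d + k) / (k + 1)) with h | h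
    · rw [h.add_one.neg_one_pow, Nat.even_iff.1 h, Nat.odd_iff.1 h.add_one]
      rfl
    · rw [h.add_one.neg_one_pow, Nat.odd_iff.1 h, Nat.even_iff.1 h.add_one]
      rfl
end

section
/- Let n > k ≥ 1 be integers and let G be a nonempty finite simple graph with m ≥ 1 vertices. Then the domination polynomial of the corona of G with the (k,n)-star satisfies D(G ∘ S_{k,n−k}, x) = (D(S_{k+1,n−k}, x))^m as polynomials in x, where S_{k+1,n−k} denotes the (k+1, n+1)-star (join of K_{k+1} with n−k independent vertices). -/
open Polynomial

theorem IsDomSet.map_iso {V W : Type*} {G : SimpleGraph V} {H : SimpleGraph W} (e : G ≃g H)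
    {S : Finset V} (hS : IsDomSet G S) : IsDomSet H (S.map e.toEquiv.toEmbedding) := by
  intro w hw
  obtain ⟨v, rfl⟩ := e.surjective w
  obtain ⟨u, hu, huv⟩ := hS v fun h => hw (Finset.mem_map_of_mem e.toEquiv.toEmbedding h)
  exact ⟨e u, Finset.mem_map_of_mem e.toEquiv.toEmbedding hu, e.map_adj_iff.2 huv⟩

theorem domPoly_congr {V W : Type*} [Fintype V] [Fintype W] {G : SimpleGraph V}
    {H : SimpleGraph W} (e : G ≃g H) : domPoly G = domPoly H := by
  classical
  unfold domPoly
  refine Finset.sum_nbij' (fun S => S.map e.toEquiv.toEmbedding)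
    (fun S => S.map e.symm.toEquiv.toEmbedding) ?_ ?_ ?_ ?_ ?_
  · intro S hS
    simp only [Finset.mem_filter, Finset.mem_univ, true_and] at hS ⊢
    exact hS.map_iso e
  · intro S hS
    simp only [Finset.mem_filter, Finset.mem_univ, true_and] at hS ⊢
    exact hS.map_iso e.symm
  · intro S _
    ext v
    simp only [Finset.mem_map_equiv]
    exact iff_of_eq (congrArg (· ∈ S) (e.symm_apply_apply v))
  · intro S _
    ext v
    simp only [Finset.mem_map_equiv]
    exact iff_of_eq (congrArg (· ∈ S) (e.apply_symm_apply v))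
  · intro S _
    rw [Finset.card_map]

/-- The cone over `H`: the graph `H` together with a new vertex `none` adjacent to all others. -/
def cone {W : Type*} (H : SimpleGraph W) : SimpleGraph (Option W) where
  Adj
    | none, none => False
    | none, some _ => True
    | some _, none => True
    | some w, some w' => H.Adj w w'
  symm := ⟨by
    rintro (_ | w) (_ | w') h
    exacts [h, trivial, trivial, H.adj_symm h]⟩
  loopless := ⟨by
    rintro (_ | w) h
    exacts [h, H.loopless.irrefl w h]⟩

@[simp]
theorem cone_adj_none_some {W : Type*} (H : SimpleGraph W) (w : W) :
    (cone H).Adj none (some w) := trivial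

@[simp]
theorem cone_adj_some_none {W : Type*} (H : SimpleGraph W) (w : W) :
    (cone H).Adj (some w) none := trivial

@[simp]
theorem cone_adj_some_some {W : Type*} (H : SimpleGraph W) (w w' : W) :
    (cone H).Adj (some w) (some w') ↔ H.Adj w w' := Iff.rfl

/-- The star `kStar (k + 1) (n + 1)` is the cone over `kStar k n`. -/
def coneKStarIso (k n : ℕ) : cone (kStar k n) ≃g kStar (k + 1) (n + 1) where
  toEquiv := (finSuccEquiv n).symm
  map_rel_iff' := by
    rintro (_ | w) (_ | w') <;> simp [kStar, Fin.succ_ne_zero, (Fin.succ_ne_zero _).symm]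

section Corona

variable {V W : Type*} (G : SimpleGraph V) (H : SimpleGraph W)

@[simp]
theorem corona_adj_inl_inr (u v : V) (w : W) :
    (corona G H).Adj (Sum.inl u) (Sum.inr (v, w)) ↔ u = v := by
  simp [corona, eq_comm]

@[simp]
theorem corona_adj_inr_inl (u v : V) (w : W) :
    (corona G H).Adj (Sum.inr (v, w)) (Sum.inl u) ↔ u = v := by
  rw [SimpleGraph.adj_comm, corona_adj_inl_inr]

@[simp]
theorem corona_adj_inr_inr (u v : V) (w w' : W) :
    (corona G H).Adj (Sum.inr (u, w)) (Sum.inr (v, w')) ↔ u = v ∧ H.Adj w w' := by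
  simp only [corona, SimpleGraph.fromRel_adj]
  constructor
  · rintro ⟨-, h⟩
    have := H.adj_comm w w'
    simp at h
    grind
  · rintro ⟨rfl, h⟩
    simp [h, h.ne]

/-- The vertices of a corona over `v` are `v` itself and the copy of `H` attached to `v`. -/
def coronaVertex (v : V) : Option W → V ⊕ V × W
  | none => Sum.inl v
  | some w => Sum.inr (v, w)

open scoped Classical in
/-- The part over `v` of a set of vertices of a corona. -/
noncomputable def coronaFiber [Fintype W] (S : Finset (V ⊕ V × W)) (v : V) :
    Finset (Option W) :=
  Finset.univ.filter fun o => coronaVertex v o ∈ S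

theorem mem_coronaFiber [Fintype W] {S : Finset (V ⊕ V × W)} {v : V} {o : Option W} :
    o ∈ coronaFiber S v ↔ coronaVertex v o ∈ S := by
  simp [coronaFiber]

@[simp]
theorem mem_coronaFiber_none [Fintype W] {S : Finset (V ⊕ V × W)} {v : V} :
    none ∈ coronaFiber S v ↔ Sum.inl v ∈ S :=
  mem_coronaFiber

@[simp]
theorem mem_coronaFiber_some [Fintype W] {S : Finset (V ⊕ V × W)} {v : V} {w : W} :
    some w ∈ coronaFiber S v ↔ Sum.inr (v, w) ∈ S :=
  mem_coronaFiber

open scoped Classical in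
theorem sum_card_coronaFiber [Fintype V] [Fintype W] (S : Finset (V ⊕ V × W)) :
    ∑ v, (coronaFiber S v).card = S.card := by
  have h : S.card = ∑ a, if a ∈ S then 1 else 0 := by simp
  rw [h, Fintype.sum_sum_type, Fintype.sum_prod_type, ← Finset.sum_add_distrib]
  refine Finset.sum_congr rfl fun v _ => ?_
  rw [coronaFiber, Finset.card_filter, Fintype.sum_option]
  rfl

theorem isDomSet_corona_iff [Fintype W] [Nonempty W] (S : Finset (V ⊕ V × W)) :
    IsDomSet (corona G H) S ↔ ∀ v, IsDomSet (cone H) (coronaFiber S v) := by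
  constructor
  · intro hS v
    have key : ∀ w, Sum.inr (v, w) ∉ S →
        ∃ o ∈ coronaFiber S v, (cone H).Adj o (some w) := by
      intro w hw
      obtain ⟨u | ⟨u, w'⟩, hu, hadj⟩ := hS _ hw
      · obtain rfl := (corona_adj_inl_inr G H _ _ _).1 hadj
        exact ⟨none, by simpa using hu, by simp⟩
      · obtain ⟨rfl, h⟩ := (corona_adj_inr_inr G H _ _ _ _).1 hadj
        exact ⟨some w', by simpa using hu, by simpa using h⟩
    rintro (_ | w) hw
    · obtain ⟨w₀⟩ := ‹Nonempty W›
      by_cases h₀ : Sum.inr (v, w₀) ∈ S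
      · exact ⟨some w₀, by simpa using h₀, by simp⟩
      · obtain ⟨_ | w', hw', -⟩ := key w₀ h₀
        · exact absurd hw' hw
        · exact ⟨some w', hw', by simp⟩
    · exact key w (by simpa using hw)
  · rintro hS (v | ⟨v, w⟩) hv
    · obtain ⟨_ | w, hw, hadj⟩ := hS v none (by simpa using hv)
      · exact absurd hadj ((cone H).irrefl)
      · exact ⟨Sum.inr (v, w), by simpa using hw, by simp⟩
    · obtain ⟨_ | w', hw', hadj⟩ := hS v (some w) (by simpa using hv)
      · exact ⟨Sum.inl v, by simpa using hw', by simp⟩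
      · exact ⟨Sum.inr (v, w'), by simpa using hw', by simpa using hadj⟩

theorem coronaFiber_bijective [Fintype V] [Fintype W] :
    Function.Bijective (coronaFiber : Finset (V ⊕ V × W) → V → Finset (Option W)) := by
  classical
  constructor
  · intro S T h
    ext (v | ⟨v, w⟩)
    · rw [← mem_coronaFiber_none, h, mem_coronaFiber_none]
    · rw [← mem_coronaFiber_some, h, mem_coronaFiber_some]
  · intro f
    refine ⟨Finset.univ.filter
      (Sum.elim (fun v => none ∈ f v) fun p => some p.2 ∈ f p.1), ?_⟩
    ext v (_ | w) <;> simp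

/-- The domination polynomial of a corona is a power of that of the cone. -/
theorem domPoly_corona [Fintype V] [Fintype W] [Nonempty W] :
    domPoly (corona G H) = domPoly (cone H) ^ Fintype.card V := by
  classical
  have hpow : domPoly (cone H) ^ Fintype.card V = ∏ _v : V, domPoly (cone H) := by simp
  rw [hpow]
  unfold domPoly
  rw [Finset.prod_univ_sum]
  refine Finset.sum_bij (fun S _ => coronaFiber S) ?_ ?_ ?_ ?_
  · intro S hS
    simpa [isDomSet_corona_iff] using hS
  · intro S _ T _ h
    exact coronaFiber_bijective.1 h
  · intro f hf
    obtain ⟨S, rfl⟩ := coronaFiber_bijective.2 f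
    exact ⟨S, by simpa [isDomSet_corona_iff] using hf, rfl⟩
  · intro S _
    rw [Finset.prod_pow_eq_pow_sum, sum_card_coronaFiber]

end Corona

theorem domPoly_corona_kStar {V : Type*} [Fintype V] (G : SimpleGraph V)
    (k n m : ℕ) (hk : 1 ≤ k) (hn : k < n) (hm : 1 ≤ m) (hcard : Fintype.card V = m) :
    domPoly (corona G (kStar k n)) = (domPoly (kStar (k + 1) (n + 1))) ^ m := by
  have : Nonempty (Fin n) := ⟨⟨k, hn⟩⟩
  rw [domPoly_corona, hcard, domPoly_congr (coneKStarIso k n)]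
end
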